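/- arXiv:1904.00901 — 8 statements merged into one kernel-verified Lean document; each statement's English description precedes it below -/
import Mathlib

section
/- Let n ≥ 1 and suppose β_1, …, β_n are real numbers such that the probabilists' Hermite polynomial of degree 2n+1 factors as He_{2n+1}(X) = X · ∏_{j=1}^{n} (X² − β_j²). Then for all real u, v one has (2n+1)! · P_{2n+1}(u,v) = u · ∏_{j=1}^{n} (u² + 2 β_j² v), where P_{2n+1} is the elementary Schur polynomial of two variables. -/
/-- Elementary Schur polynomial of two variables:
`P_k(u,v) = Σ_{i=0}^{⌊k/2⌋} u^(k−2i) v^i / ((k−2i)! i!)`. -/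
noncomputable def schurP (k : ℕ) (u v : ℝ) : ℝ :=
  ∑ i ∈ Finset.range (k / 2 + 1),
    u ^ (k - 2 * i) * v ^ i / ((k - 2 * i).factorial * i.factorial : ℝ)

/-- The coefficient of `X ^ k` in the Hermite polynomial of degree `2 * i + k`, in terms of
factorials. -/
theorem coeff_hermite_eq_factorial_div (i k : ℕ) :
    ((Polynomial.hermite (2 * i + k)).coeff k : ℝ) =
      (2 * i + k).factorial * (-1 / 2) ^ i / (k.factorial * i.factorial) := by
  have hfac : ((2 * i).factorial : ℝ) = 2 ^ i * i.factorial * Nat.doubleFactorial (2 * i - 1) := by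
    rcases i with _ | j
    · simp
    · have h := Nat.factorial_eq_mul_doubleFactorial (2 * j + 1)
      rw [show 2 * j + 1 + 1 = 2 * (j + 1) by ring, Nat.doubleFactorial_two_mul] at h
      rw [h, show 2 * (j + 1) - 1 = 2 * j + 1 by omega]
      push_cast
      ring
  have hchoose : (((2 * i + k).choose k : ℕ) : ℝ) * (2 * i).factorial * k.factorial =
      (2 * i + k).factorial := by
    have h := Nat.choose_mul_factorial_mul_factorial (Nat.le_add_left k (2 * i))
    rw [Nat.add_sub_cancel, mul_right_comm] at h
    exact_mod_cast h
  rw [Polynomial.coeff_hermite_explicit, ← hchoose, hfac, div_pow]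
  push_cast
  field_simp

theorem aeval_hermite_eq_factorial_mul_schurP (n : ℕ) (x : ℝ) :
    Polynomial.aeval x (Polynomial.hermite (2 * n + 1)) =
      (2 * n + 1).factorial * schurP (2 * n + 1) x (-1 / 2) := by
  have hsplit (f : ℕ → ℝ) (N : ℕ) :
      ∑ k ∈ Finset.range (2 * N), f k = ∑ j ∈ Finset.range N, (f (2 * j) + f (2 * j + 1)) := by
    induction N with
    | zero => simp
    | succ N ih =>
      rw [mul_add_one, Finset.sum_range_succ, Finset.sum_range_succ, ih, Finset.sum_range_succ,
        add_assoc]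
  rw [Polynomial.aeval_eq_sum_range, Polynomial.natDegree_hermite,
    show 2 * n + 1 + 1 = 2 * (n + 1) by ring, hsplit, ← Finset.sum_range_reflect, schurP,
    Finset.mul_sum, show (2 * n + 1) / 2 = n by omega]
  refine Finset.sum_congr rfl fun i hi => ?_
  have hi : i ≤ n := by simpa [Nat.lt_succ_iff] using hi
  obtain ⟨j, rfl⟩ := Nat.exists_eq_add_of_le hi
  have hcoeff := coeff_hermite_eq_factorial_div i (2 * j + 1)
  rw [show 2 * i + (2 * j + 1) = 2 * (i + j) + 1 by ring] at hcoeff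
  rw [show i + j + 1 - 1 - i = j by omega,
    show 2 * (i + j) + 1 - 2 * i = 2 * j + 1 by omega,
    Polynomial.coeff_hermite_of_odd_add ⟨i + 2 * j, by ring⟩, zsmul_eq_mul, zsmul_eq_mul, hcoeff]
  push_cast
  ring

/-- The elementary Schur polynomial of degree `2 * n + 1` is `u` times the homogenization of a
polynomial in `u ^ 2`, evaluated at `-2 * v`. -/
theorem factorial_mul_schurP_eq (n : ℕ) (u v : ℝ) :
    (2 * n + 1).factorial * schurP (2 * n + 1) u v =
      u * ∑ i ∈ Finset.range (n + 1), (2 * n + 1).factorial * (-1 / 2) ^ i /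
        ((2 * n + 1 - 2 * i).factorial * i.factorial) * (u ^ 2) ^ (n - i) * (-2 * v) ^ i := by
  rw [schurP, Finset.mul_sum, Finset.mul_sum, show (2 * n + 1) / 2 = n by omega]
  refine Finset.sum_congr rfl fun i hi => ?_
  have hi : i ≤ n := by simpa [Nat.lt_succ_iff] using hi
  have hv : v ^ i = (-1 / 2) ^ i * (-2 * v) ^ i := by
    rw [← mul_pow]
    congr 1
    ring
  rw [show u ^ (2 * n + 1 - 2 * i) = u * (u ^ 2) ^ (n - i) by
    rw [← pow_mul, ← pow_succ']; congr 1; omega, hv]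
  ring

/-- A factorization of the dehomogenization into linear factors homogenizes. -/
theorem sum_mul_pow_eq_prod_sub_mul {n : ℕ} (c : ℕ → ℝ) (b : Fin n → ℝ) (hc : c 0 = 1)
    (h : ∀ y : ℝ, 0 < y →
      ∑ i ∈ Finset.range (n + 1), c i * y ^ (n - i) = ∏ j, (y - b j)) (y t : ℝ) :
    ∑ i ∈ Finset.range (n + 1), c i * y ^ (n - i) * t ^ i = ∏ j, (y - b j * t) := by
  rcases eq_or_ne t 0 with rfl | ht
  · rw [Finset.sum_eq_single 0 (fun i _ hi => by simp [hi]) (by simp)]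
    simp [hc]
  have hpoly : (∑ i ∈ Finset.range (n + 1), Polynomial.C (c i) * Polynomial.X ^ (n - i)) =
      ∏ j, (Polynomial.X - Polynomial.C (b j)) := by
    refine Polynomial.eq_of_infinite_eval_eq _ _ ((Set.Ioi_infinite (0 : ℝ)).mono fun y hy => ?_)
    simpa [Polynomial.eval_finsetSum, Polynomial.eval_prod] using h y hy
  have heval := congrArg (Polynomial.eval (y / t)) hpoly
  simp only [Polynomial.eval_finsetSum, Polynomial.eval_prod, Polynomial.eval_mul,
    Polynomial.eval_pow, Polynomial.eval_C, Polynomial.eval_X, Polynomial.eval_sub] at heval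
  calc ∑ i ∈ Finset.range (n + 1), c i * y ^ (n - i) * t ^ i
      = t ^ n * ∑ i ∈ Finset.range (n + 1), c i * (y / t) ^ (n - i) := by
        rw [Finset.mul_sum]
        refine Finset.sum_congr rfl fun i hi => ?_
        have hi : i ≤ n := by simpa [Nat.lt_succ_iff] using hi
        rw [← Nat.sub_add_cancel hi, pow_add, Nat.sub_add_cancel hi, div_pow]
        field_simp
    _ = ∏ j, (t * (y / t - b j)) := by
        rw [heval, Finset.prod_mul_distrib]
        simp
    _ = ∏ j, (y - b j * t) := Finset.prod_congr rfl fun j _ => by field_simp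

theorem stmt0 (n : ℕ) (hn : 1 ≤ n) (β : Fin n → ℝ)
    (hβ : ∀ X : ℝ, (Polynomial.aeval X) (Polynomial.hermite (2 * n + 1)) =
      X * ∏ j, (X ^ 2 - (β j) ^ 2)) :
    ∀ u v : ℝ, ((2 * n + 1).factorial : ℝ) * schurP (2 * n + 1) u v =
      u * ∏ j, (u ^ 2 + 2 * (β j) ^ 2 * v) := by
  intro u v
  rw [factorial_mul_schurP_eq, sum_mul_pow_eq_prod_sub_mul _ (fun j => β j ^ 2)]
  · congr 1
    exact Finset.prod_congr rfl fun j _ => by ring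
  · have := Nat.factorial_ne_zero (2 * n + 1)
    simp [this]
  · intro y hy
    have h := hβ (√y)
    rw [aeval_hermite_eq_factorial_mul_schurP, factorial_mul_schurP_eq, Real.sq_sqrt hy.le,
      show (-2 * (-1 / 2) : ℝ) = 1 by norm_num] at h
    simpa using mul_left_cancel₀ (Real.sqrt_pos.2 hy).ne' h
end

section
/- Let n ≥ 1 and suppose β_1, …, β_n are real numbers such that the probabilists' Hermite polynomial of degree 2n factors as He_{2n}(X) = ∏_{j=1}^{n} (X² − β_j²). Then for all real u, v one has (2n)! · P_{2n}(u,v) = ∏_{j=1}^{n} (u² + 2 β_j² v), where P_{2n} is the elementary Schur polynomial of two variables. -/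
theorem sum_range_two_mul_add_one_of_odd_eq_zero {M : Type*} [AddCommMonoid M] {f : ℕ → M}
    (hf : ∀ j, f (2 * j + 1) = 0) (n : ℕ) :
    ∑ k ∈ Finset.range (2 * n + 1), f k = ∑ j ∈ Finset.range (n + 1), f (2 * j) := by
  induction n with
  | zero => simp
  | succ n ih =>
    rw [Finset.sum_range_succ _ (n + 1), ← ih, show 2 * (n + 1) + 1 = 2 * n + 1 + 1 + 1 by ring,
      Finset.sum_range_succ, Finset.sum_range_succ _ (2 * n + 1), hf, add_zero]
    rfl

theorem two_mul_factorial_eq (i : ℕ) :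
    (2 * i).factorial = (2 * i - 1).doubleFactorial * (2 ^ i * i.factorial) := by
  cases i with
  | zero => simp
  | succ i =>
    rw [← Nat.doubleFactorial_two_mul, show 2 * (i + 1) = 2 * i + 1 + 1 by ring,
      Nat.factorial_eq_mul_doubleFactorial, mul_comm]
    rfl

theorem coeff_hermite_two_mul {n i : ℕ} (hi : i ≤ n) :
    ((Polynomial.hermite (2 * n)).coeff (2 * (n - i)) : ℝ) =
      (2 * n).factorial * (-1 / 2) ^ i / ((2 * n - 2 * i).factorial * i.factorial) := by
  obtain ⟨k, rfl⟩ := Nat.exists_eq_add_of_le hi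
  have hfac : ((2 * i).factorial : ℝ) =
      (2 * i - 1).doubleFactorial * (2 ^ i * i.factorial) := by
    exact_mod_cast two_mul_factorial_eq i
  have hd : ((2 * i - 1).doubleFactorial : ℝ) ≠ 0 :=
    Nat.cast_ne_zero.2 (Nat.doubleFactorial_pos _).ne'
  rw [show i + k - i = k by lia, show 2 * (i + k) - 2 * i = 2 * k by lia,
    show 2 * (i + k) = 2 * i + 2 * k by ring, Polynomial.coeff_hermite_explicit]
  push_cast
  rw [Nat.cast_choose ℝ (Nat.le_add_left _ _), Nat.add_sub_cancel, hfac, div_pow]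
  have h1 := Nat.factorial_ne_zero (2 * k)
  have h2 := Nat.factorial_ne_zero i
  field_simp

theorem aeval_hermite_two_mul (n : ℕ) (x : ℝ) :
    Polynomial.aeval x (Polynomial.hermite (2 * n)) =
      (2 * n).factorial * ∑ i ∈ Finset.range (n + 1),
        (x ^ 2) ^ (n - i) * (-1 / 2) ^ i / ((2 * n - 2 * i).factorial * i.factorial) := by
  rw [Polynomial.aeval_eq_sum_range, Polynomial.natDegree_hermite,
    sum_range_two_mul_add_one_of_odd_eq_zero, ← Finset.sum_range_reflect, Finset.mul_sum]
  · refine Finset.sum_congr rfl fun i hi => ?_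
    have hi : i ≤ n := Nat.lt_succ_iff.1 (Finset.mem_range.1 hi)
    rw [show n + 1 - 1 - i = n - i by lia, zsmul_eq_mul, coeff_hermite_two_mul hi, pow_mul]
    ring
  · intro j
    rw [Polynomial.coeff_hermite_of_odd_add ⟨n + j, by ring⟩, zero_smul]

/-- A one-variable factorization that holds at squares holds at every real number. -/
theorem sum_eq_prod_of_forall_sq {n : ℕ} (c : ℕ → ℝ) (b : Fin n → ℝ)
    (h : ∀ x : ℝ, ∑ i ∈ Finset.range (n + 1), c i * (x ^ 2) ^ (n - i) = ∏ j, (x ^ 2 - b j))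
    (t : ℝ) :
    ∑ i ∈ Finset.range (n + 1), c i * t ^ (n - i) = ∏ j, (t - b j) := by
  have key : ∑ i ∈ Finset.range (n + 1), Polynomial.C (c i) * Polynomial.X ^ (n - i) =
      ∏ j, (Polynomial.X - Polynomial.C (b j)) := by
    refine Polynomial.eq_of_infinite_eval_eq _ _ ((Set.Ici_infinite (0 : ℝ)).mono fun s hs => ?_)
    have := h (Real.sqrt s)
    rw [Real.sq_sqrt hs] at this
    simpa [Polynomial.eval_finsetSum, Polynomial.eval_prod] using this
  simpa [Polynomial.eval_finsetSum, Polynomial.eval_prod] using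
    congrArg (Polynomial.eval t) key

/-- Homogenization of a one-variable factorization. -/
theorem sum_homogenize_eq_prod {n : ℕ} {c : ℕ → ℝ} {b : Fin n → ℝ} (hc : c 0 = 1)
    (h : ∀ t : ℝ, ∑ i ∈ Finset.range (n + 1), c i * t ^ (n - i) = ∏ j, (t - b j))
    (s w : ℝ) :
    ∑ i ∈ Finset.range (n + 1), c i * (s ^ (n - i) * w ^ i) = ∏ j, (s - b j * w) := by
  rcases eq_or_ne w 0 with rfl | hw
  · rw [Finset.sum_eq_single 0 (fun i _ hi => by simp [hi]) (by simp)]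
    simp [hc]
  · have hprod : ∏ j, (s - b j * w) = w ^ n * ∏ j, (s / w - b j) := by
      rw [← Fin.prod_const, ← Finset.prod_mul_distrib]
      refine Finset.prod_congr rfl fun j _ => ?_
      field_simp
    rw [hprod, ← h, Finset.mul_sum]
    refine Finset.sum_congr rfl fun i hi => ?_
    have hi : i ≤ n := Nat.lt_succ_iff.1 (Finset.mem_range.1 hi)
    rw [div_pow, ← pow_sub_mul_pow w hi]
    field_simp

theorem stmt1 (n : ℕ) (hn : 1 ≤ n) (β : Fin n → ℝ)
    (hβ : ∀ X : ℝ, (Polynomial.aeval X) (Polynomial.hermite (2 * n)) =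
      ∏ j, (X ^ 2 - (β j) ^ 2)) :
    ∀ u v : ℝ, ((2 * n).factorial : ℝ) * schurP (2 * n) u v =
      ∏ j, (u ^ 2 + 2 * (β j) ^ 2 * v) := by
  intro u v
  set c : ℕ → ℝ := fun i =>
    (2 * n).factorial * (-1 / 2) ^ i / ((2 * n - 2 * i).factorial * i.factorial) with hc
  have hc0 : c 0 = 1 := by
    simp [hc, (Nat.factorial_pos (2 * n)).ne']
  have hsq : ∀ x : ℝ, ∑ i ∈ Finset.range (n + 1), c i * (x ^ 2) ^ (n - i) =
      ∏ j, (x ^ 2 - β j ^ 2) := fun x => by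
    rw [← hβ, aeval_hermite_two_mul, Finset.mul_sum]
    exact Finset.sum_congr rfl fun i _ => by simp only [hc]; ring
  have hhom := sum_homogenize_eq_prod hc0 (sum_eq_prod_of_forall_sq c _ hsq) (u ^ 2) (-2 * v)
  calc ((2 * n).factorial : ℝ) * schurP (2 * n) u v
      = ∑ i ∈ Finset.range (n + 1), c i * ((u ^ 2) ^ (n - i) * (-2 * v) ^ i) := by
        rw [schurP, Nat.mul_div_cancel_left n two_pos, Finset.mul_sum]
        refine Finset.sum_congr rfl fun i _ => ?_
        have hv : (-1 / 2 : ℝ) ^ i * (-2 * v) ^ i = v ^ i := by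
          rw [← mul_pow]
          ring
        simp only [hc]
        rw [← hv, ← Nat.mul_sub, pow_mul]
        ring
    _ = ∏ j, (u ^ 2 + 2 * β j ^ 2 * v) := by
        rw [hhom]
        exact Finset.prod_congr rfl fun j _ => by ring
end

section
/- Let λ: ℝ² → ℝ be C² with λ_u(u,v) ≠ 0 for all (u,v), and let ω: ℝ² → ℝ be C² satisfying ω_{uu} + (λ_v − λ_{uu}/λ_u) ω_u − λ_u ω_v = 0 everywhere. Define t(u,v) = ω_u/λ_u and x(u,v) = ω − (λ/λ_u) ω_u. Then t and x satisfy the parabolic hodograph equations x_u = −λ t_u and x_v = t_u − λ t_v everywhere. -/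
/-- Partial derivative in the first variable `u`. -/
noncomputable def pu (f : ℝ × ℝ → ℝ) (p : ℝ × ℝ) : ℝ := fderiv ℝ f p (1, 0)

/-- Partial derivative in the second variable `v`. -/
noncomputable def pv (f : ℝ × ℝ → ℝ) (p : ℝ × ℝ) : ℝ := fderiv ℝ f p (0, 1)

theorem ContDiff.differentiable_pu {f : ℝ × ℝ → ℝ} (hf : ContDiff ℝ 2 f) :
    Differentiable ℝ (pu f) :=
  ((hf.fderiv_right (m := 1) (by norm_num)).differentiable one_ne_zero).clm_apply
    (differentiable_const _)

theorem fderiv_sub_mul_apply {E : Type*} [NormedAddCommGroup E] [NormedSpace ℝ E]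
    {f g h : E → ℝ} {p : E} (hf : DifferentiableAt ℝ f p)
    (hg : DifferentiableAt ℝ g p) (hh : DifferentiableAt ℝ h p) (w : E) :
    fderiv ℝ (fun q => f q - g q * h q) p w =
      fderiv ℝ f p w - (g p * fderiv ℝ h p w + h p * fderiv ℝ g p w) := by
  rw [fderiv_fun_sub hf (hg.fun_mul hh), fderiv_fun_mul hg hh]
  simp

theorem pu_mul {f g : ℝ × ℝ → ℝ} {p : ℝ × ℝ} (hf : DifferentiableAt ℝ f p)
    (hg : DifferentiableAt ℝ g p) :
    pu (fun q => f q * g q) p = f p * pu g p + g p * pu f p := by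
  unfold pu
  rw [fderiv_fun_mul hf hg]
  simp

theorem stmt5 (lam ω : ℝ × ℝ → ℝ) (hlam : ContDiff ℝ 2 lam) (hω : ContDiff ℝ 2 ω)
    (hlu : ∀ p, pu lam p ≠ 0)
    (hpde : ∀ p, pu (pu ω) p + (pv lam p - pu (pu lam) p / pu lam p) * pu ω p
      - pu lam p * pv ω p = 0)
    (t x : ℝ × ℝ → ℝ)
    (ht : ∀ p, t p = pu ω p / pu lam p)
    (hx : ∀ p, x p = ω p - lam p / pu lam p * pu ω p) :
    ∀ p, pu x p = -lam p * pu t p ∧ pv x p = pu t p - lam p * pv t p := by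
  intro p
  have hdlu := hlam.differentiable_pu
  have hdωu := hω.differentiable_pu
  have hdt : Differentiable ℝ t := by
    rw [show t = fun q => pu ω q / pu lam q from funext ht]
    simp only [div_eq_mul_inv]
    exact hdωu.fun_mul (hdlu.fun_inv hlu)
  have hx' : x = fun q => ω q - lam q * t q := by
    funext q
    rw [hx, ht]
    ring
  have hωu : pu ω = fun q => pu lam q * t q := by
    funext q
    rw [ht, mul_div_cancel₀ _ (hlu q)]
  have hωuu : pu (pu ω) p = pu lam p * pu t p + t p * pu (pu lam) p := by
    conv_lhs => rw [hωu]
    exact pu_mul (hdlu p) (hdt p)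
  have hdx := fderiv_sub_mul_apply (hω.differentiable two_ne_zero p)
    (hlam.differentiable two_ne_zero p) (hdt p)
  have hxu : pu x p = pu ω p - (lam p * pu t p + t p * pu lam p) := hx' ▸ hdx (1, 0)
  have hxv : pv x p = pv ω p - (lam p * pv t p + t p * pv lam p) := hx' ▸ hdx (0, 1)
  have hωup : pu ω p = pu lam p * t p := congrFun hωu p
  have htu : pu t p = pv ω p - t p * pv lam p := by
    have h := hpde p
    rw [hωuu, hωup] at h
    have hne := hlu p
    field_simp at h
    refine mul_left_cancel₀ hne ?_
    linear_combination h
  constructor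
  · rw [hxu, hωup]
    ring
  · rw [hxv, htu]
    ring
end

section
/- Let λ: ℝ² → ℝ be C¹, let t: ℝ² → ℝ be C³ satisfying t_{uu} = λ_u t_v − λ_v t_u everywhere, and let x: ℝ² → ℝ be C² satisfying x_u = −λ t_u, x_v = t_u − λ t_v everywhere. Define the vector field X f = −t_{uv} f_u + t_{uu} f_v acting on C¹ functions f. Then at every point p with t_u(p) = 0 and t_v(p) = 0 one has (X t)(p) = 0, (X x)(p) = 0, and also the second-order derivatives vanish: (X(X t))(p) = 0 and (X(X x))(p) = 0. (Thus, in contrast to generic plane-to-plane mappings, the vanishing of the first Whitney derivative at a singular point forces the vanishing of the second, so parabolic mappings have no standard Whitney cusp points.) -/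
/-- The vector field tangent to the singular curve `{t_u = 0}`:
`X f = −t_{uv} f_u + t_{uu} f_v`, viewed as an operator taking a function `f`
to the function `X f`. -/
noncomputable def Xop (t f : ℝ × ℝ → ℝ) : ℝ × ℝ → ℝ := fun p =>
  -(pv (pu t) p) * pu f p + (pu (pu t) p) * pv f p

theorem contDiff_pu {n m : WithTop ℕ∞} {f : ℝ × ℝ → ℝ} (hf : ContDiff ℝ n f) (h : m + 1 ≤ n) :
    ContDiff ℝ m (pu f) :=
  (hf.fderiv_right h).clm_apply contDiff_const

theorem contDiff_pv {n m : WithTop ℕ∞} {f : ℝ × ℝ → ℝ} (hf : ContDiff ℝ n f) (h : m + 1 ≤ n) :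
    ContDiff ℝ m (pv f) :=
  (hf.fderiv_right h).clm_apply contDiff_const

theorem pu_add {f g : ℝ × ℝ → ℝ} {p : ℝ × ℝ} (hf : DifferentiableAt ℝ f p)
    (hg : DifferentiableAt ℝ g p) :
    pu (fun q => f q + g q) p = pu f p + pu g p := by
  simp [pu, fderiv_fun_add hf hg]

theorem Xop_eq_zero {t f : ℝ × ℝ → ℝ} {p : ℝ × ℝ} (hu : pu f p = 0) (hv : pv f p = 0) :
    Xop t f p = 0 := by
  simp [Xop, hu, hv]

/-- If `X` is parallel to `∂_u` at a critical point `p` of `f` with `f_{uu}(p) = 0`, then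
`X (X f)` vanishes at `p`. -/
theorem Xop_Xop_eq_zero {t f : ℝ × ℝ → ℝ} {p : ℝ × ℝ} (ht : ContDiff ℝ 3 t)
    (hf : ContDiff ℝ 2 f) (htuu : pu (pu t) p = 0) (hu : pu f p = 0) (hv : pv f p = 0)
    (huu : pu (pu f) p = 0) : Xop t (Xop t f) p = 0 := by
  have htu : ContDiff ℝ 2 (pu t) := contDiff_pu ht (by norm_num)
  have dtuv : DifferentiableAt ℝ (fun q => -(pv (pu t) q)) p :=
    ((contDiff_pv (m := 1) htu (by norm_num)).differentiable one_ne_zero p).fun_neg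
  have dtuu : DifferentiableAt ℝ (pu (pu t)) p :=
    (contDiff_pu (m := 1) htu (by norm_num)).differentiable one_ne_zero p
  have dfu : DifferentiableAt ℝ (pu f) p :=
    (contDiff_pu (m := 1) hf (by norm_num)).differentiable one_ne_zero p
  have dfv : DifferentiableAt ℝ (pv f) p :=
    (contDiff_pv (m := 1) hf (by norm_num)).differentiable one_ne_zero p
  have key : pu (Xop t f) p = 0 := by
    unfold Xop
    rw [pu_add (dtuv.fun_mul dfu) (dtuu.fun_mul dfv), pu_mul dtuv dfu, pu_mul dtuu dfv]
    simp [htuu, hu, hv, huu]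
  rw [Xop, key, htuu]
  ring

theorem stmt9 (lam t x : ℝ × ℝ → ℝ) (hlam : ContDiff ℝ 1 lam)
    (ht : ContDiff ℝ 3 t) (hx : ContDiff ℝ 2 x)
    (hcomp : ∀ p, pu (pu t) p = pu lam p * pv t p - pv lam p * pu t p)
    (h1 : ∀ p, pu x p = -lam p * pu t p)
    (h2 : ∀ p, pv x p = pu t p - lam p * pv t p) :
    ∀ p, pu t p = 0 → pv t p = 0 →
      Xop t t p = 0 ∧ Xop t x p = 0 ∧ Xop t (Xop t t) p = 0 ∧ Xop t (Xop t x) p = 0 := by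
  intro p hu hv
  have htuu : pu (pu t) p = 0 := by simp [hcomp, hu, hv]
  have hxu : pu x p = 0 := by simp [h1, hu]
  have hxv : pv x p = 0 := by simp [h2, hu, hv]
  have dtu : DifferentiableAt ℝ (pu t) p :=
    (contDiff_pu (m := 2) ht (by norm_num)).differentiable two_ne_zero p
  have hxuu : pu (pu x) p = 0 := by
    rw [funext h1, pu_mul (hlam.differentiable one_ne_zero p).fun_neg dtu, htuu, hu]
    ring
  exact ⟨Xop_eq_zero hu hv, Xop_eq_zero hxu hxv,
    Xop_Xop_eq_zero ht (ht.of_le (by norm_num)) htuu hu hv htuu,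
    Xop_Xop_eq_zero ht hx htuu hxu hxv hxuu⟩
end

section
/- Let t, x: ℝ² → ℝ be C¹ functions satisfying the Jordan hodograph equations x_u + u t_u = 0 and x_v + u t_v = t_u everywhere on ℝ². Then there exists a C² function W: ℝ² → ℝ such that W_u = x + u t and W_v = t everywhere; moreover this W satisfies the heat equation W_v = W_{uu}. -/
/-- A pair of `C¹` functions on the plane with matching mixed partials has a `C²` potential. -/
theorem exists_contDiff_two_pu_pv_eq {g h : ℝ × ℝ → ℝ} (hg : ContDiff ℝ 1 g)
    (hh : ContDiff ℝ 1 h) (hgh : ∀ p, pv g p = pu h p) :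
    ∃ W : ℝ × ℝ → ℝ, ContDiff ℝ 2 W ∧ (∀ p, pu W p = g p) ∧ ∀ p, pv W p = h p := by
  let ω : ℝ × ℝ → ℝ × ℝ →L[ℝ] ℝ := fun p ↦
    g p • ContinuousLinearMap.fst ℝ ℝ ℝ + h p • ContinuousLinearMap.snd ℝ ℝ ℝ
  have hω : ContDiff ℝ 1 ω := (hg.smul contDiff_const).add (hh.smul contDiff_const)
  have hdecomp (f : ℝ × ℝ → ℝ) (p y : ℝ × ℝ) :
      fderiv ℝ f p y = y.1 * pu f p + y.2 * pv f p := by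
    have hy : y = y.1 • ((1, 0) : ℝ × ℝ) + y.2 • ((0, 1) : ℝ × ℝ) := by ext <;> simp
    conv_lhs => rw [hy, map_add, map_smul, map_smul]
    rfl
  have hdω (p y z : ℝ × ℝ) : fderiv ℝ ω p y z = fderiv ℝ g p y * z.1 + fderiv ℝ h p y * z.2 := by
    have hgp := (hg.differentiable one_ne_zero p).hasFDerivAt
    have hhp := (hh.differentiable one_ne_zero p).hasFDerivAt
    have key : HasFDerivAt ω _ p := (hgp.smul_const (ContinuousLinearMap.fst ℝ ℝ ℝ)).add
      (hhp.smul_const (ContinuousLinearMap.snd ℝ ℝ ℝ))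
    rw [key.fderiv]
    simp
  obtain ⟨W, hW⟩ := convex_univ.exists_forall_hasFDerivAt_of_fderiv_symmetric isOpen_univ
    (hω.differentiable one_ne_zero).differentiableOn fun p _ y z ↦ by
      rw [hdω, hdω, hdecomp g, hdecomp g, hdecomp h, hdecomp h, hgh p]
      ring
  refine ⟨W, ?_, fun p ↦ ?_, fun p ↦ ?_⟩
  · exact (contDiff_succ_iff_hasFDerivAt (n := 1)).2 ⟨ω, hω, fun p ↦ hW p trivial⟩
  · simp [pu, (hW p trivial).fderiv, ω]
  · simp [pv, (hW p trivial).fderiv, ω]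

/-- The derivative of `x + u t`. -/
theorem fderiv_add_fst_mul {t x : ℝ × ℝ → ℝ} {p : ℝ × ℝ} (ht : DifferentiableAt ℝ t p)
    (hx : DifferentiableAt ℝ x p) (y : ℝ × ℝ) :
    fderiv ℝ (fun q ↦ x q + q.1 * t q) p y =
      fderiv ℝ x p y + (p.1 * fderiv ℝ t p y + t p * y.1) := by
  have key : HasFDerivAt (fun q : ℝ × ℝ ↦ x q + q.1 * t q) _ p :=
    hx.hasFDerivAt.add (hasFDerivAt_fst.mul ht.hasFDerivAt)
  rw [key.fderiv]
  simp

theorem stmt10 (t x : ℝ × ℝ → ℝ) (ht : ContDiff ℝ 1 t) (hx : ContDiff ℝ 1 x)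
    (h1 : ∀ p : ℝ × ℝ, pu x p + p.1 * pu t p = 0)
    (h2 : ∀ p : ℝ × ℝ, pv x p + p.1 * pv t p = pu t p) :
    ∃ W : ℝ × ℝ → ℝ, ContDiff ℝ 2 W ∧
      (∀ p : ℝ × ℝ, pu W p = x p + p.1 * t p) ∧
      (∀ p : ℝ × ℝ, pv W p = t p) ∧
      (∀ p : ℝ × ℝ, pv W p = pu (pu W) p) := by
  have hd (p y : ℝ × ℝ) :=
    fderiv_add_fst_mul (ht.differentiable one_ne_zero p) (hx.differentiable one_ne_zero p) y
  obtain ⟨W, hW, hu, hv⟩ := exists_contDiff_two_pu_pv_eq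
    (hx.add (contDiff_fst.mul ht)) ht fun p ↦ by
      refine (hd p (0, 1)).trans ?_
      rw [← h2 p]
      simp [pv]
  refine ⟨W, hW, hu, hv, fun p ↦ ?_⟩
  have huu : pu (pu W) p = pu x p + (p.1 * pu t p + t p * 1) := by
    rw [funext hu]
    exact hd p (1, 0)
  rw [huu, hv]
  linarith [h1 p]
end

section
/- Let W: ℝ² → ℝ be C³ and satisfy the heat equation W_v = W_{uu} everywhere. Define t(u,v) = W_v and x(u,v) = W_u − u W_v. Then t and x satisfy the Jordan hodograph equations x_u + u t_u = 0 and x_v + u t_v = t_u everywhere, and the Jacobian of the mapping (u,v) ↦ (t,x) equals W_{uuu}², i.e. t_u x_v − t_v x_u = W_{uuu}² everywhere. -/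
/-- The derivative of a directional derivative of a `C²` function is its second derivative. -/
theorem fderiv_fderiv_apply_const {W : ℝ × ℝ → ℝ} (hW : ContDiff ℝ 2 W) (p a b : ℝ × ℝ) :
    fderiv ℝ (fun q => fderiv ℝ W q a) p b = fderiv ℝ (fderiv ℝ W) p b a := by
  have hd : DifferentiableAt ℝ (fderiv ℝ W) p :=
    (hW.fderiv_right (m := 1) (by norm_num)).differentiable (by norm_num) p
  rw [fderiv_clm_apply hd (differentiableAt_const a)]
  simp

/-- Mixed partial derivatives of a `C²` function commute. -/
theorem pv_pu_eq_pu_pv {W : ℝ × ℝ → ℝ} (hW : ContDiff ℝ 2 W) (p : ℝ × ℝ) :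
    pv (pu W) p = pu (pv W) p := by
  have hs : IsSymmSndFDerivAt ℝ W p := hW.contDiffAt.isSymmSndFDerivAt (by simp)
  exact (fderiv_fderiv_apply_const hW p (1, 0) (0, 1)).trans
    ((hs.eq (0, 1) (1, 0)).trans (fderiv_fderiv_apply_const hW p (0, 1) (1, 0)).symm)

/-- The derivative of `f - u g`, where `u` is the first coordinate. -/
theorem fderiv_sub_fst_mul {f g : ℝ × ℝ → ℝ} {p : ℝ × ℝ} (hf : DifferentiableAt ℝ f p)
    (hg : DifferentiableAt ℝ g p) (a : ℝ × ℝ) :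
    fderiv ℝ (fun q : ℝ × ℝ => f q - q.1 * g q) p a =
      fderiv ℝ f p a - (p.1 * fderiv ℝ g p a + g p * a.1) := by
  have h := hf.hasFDerivAt.sub ((hasFDerivAt_fst (𝕜 := ℝ) (p := p)).mul hg.hasFDerivAt)
  have h' : HasFDerivAt (fun q : ℝ × ℝ => f q - q.1 * g q) _ p := h
  rw [h'.fderiv]
  simp

theorem stmt11 (W : ℝ × ℝ → ℝ) (hW : ContDiff ℝ 3 W)
    (hheat : ∀ p, pv W p = pu (pu W) p)
    (t x : ℝ × ℝ → ℝ)
    (ht : ∀ p : ℝ × ℝ, t p = pv W p)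
    (hx : ∀ p : ℝ × ℝ, x p = pu W p - p.1 * pv W p) :
    (∀ p : ℝ × ℝ, pu x p + p.1 * pu t p = 0) ∧
    (∀ p : ℝ × ℝ, pv x p + p.1 * pv t p = pu t p) ∧
    (∀ p : ℝ × ℝ, pu t p * pv x p - pv t p * pu x p = (pu (pu (pu W)) p) ^ 2) := by
  obtain rfl : t = pv W := funext ht
  obtain rfl : x = fun p => pu W p - p.1 * pv W p := funext hx
  have hd : ∀ a p : ℝ × ℝ, DifferentiableAt ℝ (fun q => fderiv ℝ W q a) p := fun a p =>
    ((hW.fderiv_right (m := 1) (by norm_num)).clm_apply contDiff_const).differentiable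
      (by norm_num) p
  have hW2 : ContDiff ℝ 2 W := hW.of_le (by norm_num)
  have hxu : ∀ p : ℝ × ℝ, pu (fun p => pu W p - p.1 * pv W p) p = -(p.1 * pu (pv W) p) := by
    intro p
    have h : pu (fun p => pu W p - p.1 * pv W p) p =
        pu (pu W) p - (p.1 * pu (pv W) p + pv W p * 1) :=
      fderiv_sub_fst_mul (hd (1, 0) p) (hd (0, 1) p) (1, 0)
    rw [h, ← hheat p]
    ring
  have hxv : ∀ p : ℝ × ℝ, pv (fun p => pu W p - p.1 * pv W p) p =
      pu (pv W) p - p.1 * pv (pv W) p := by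
    intro p
    have h : pv (fun p => pu W p - p.1 * pv W p) p =
        pv (pu W) p - (p.1 * pv (pv W) p + pv W p * 0) :=
      fderiv_sub_fst_mul (hd (1, 0) p) (hd (0, 1) p) (0, 1)
    rw [h, pv_pu_eq_pu_pv hW2]
    ring
  refine ⟨fun p => ?_, fun p => ?_, fun p => ?_⟩
  · rw [hxu]
    ring
  · rw [hxv]
    ring
  · rw [hxu, hxv, ← (funext hheat : pv W = pu (pu W))]
    ring
end

section
/- For every integer k ≥ 0, define the mapping t(u,v) = P_{k+1}(u,v), x(u,v) = P_{k+2}(u,v) − u P_{k+1}(u,v), where P_j are the elementary Schur polynomials of two variables. Then the Jacobian of this mapping equals P_k(u,v)², i.e. t_u x_v − t_v x_u = P_k(u,v)² for all real u, v. -/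
theorem hasDerivAt_schurP_fst (n : ℕ) (u v : ℝ) :
    HasDerivAt (fun s => schurP (n + 1) s v) (schurP n u v) u := by
  unfold schurP
  have hsum : HasDerivAt (fun s : ℝ => ∑ i ∈ Finset.range ((n + 1) / 2 + 1),
      s ^ (n + 1 - 2 * i) * v ^ i / ((n + 1 - 2 * i).factorial * i.factorial : ℝ))
      (∑ i ∈ Finset.range ((n + 1) / 2 + 1),
        ((n + 1 - 2 * i : ℕ) : ℝ) * u ^ (n + 1 - 2 * i - 1) * v ^ i /
          ((n + 1 - 2 * i).factorial * i.factorial : ℝ)) u :=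
    HasDerivAt.fun_sum fun i _ => ((hasDerivAt_pow _ u).mul_const _).div_const _
  convert hsum using 1
  have hsub : Finset.range (n / 2 + 1) ⊆ Finset.range ((n + 1) / 2 + 1) := by
    intro i
    simp only [Finset.mem_range]
    omega
  rw [← Finset.sum_subset hsub]
  · refine Finset.sum_congr rfl fun i hi => ?_
    have hi' : n + 1 - 2 * i = n - 2 * i + 1 := by
      rw [Finset.mem_range] at hi
      omega
    rw [hi', Nat.factorial_succ, Nat.add_sub_cancel]
    push_cast
    have hf := Nat.cast_ne_zero (R := ℝ).2 (n - 2 * i).factorial_ne_zero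
    have hg := Nat.cast_ne_zero (R := ℝ).2 i.factorial_ne_zero
    have hs : ((n - 2 * i : ℕ) : ℝ) + 1 ≠ 0 := by positivity
    field_simp
  · intro i _ hi
    have hi' : n + 1 - 2 * i = 0 := by
      rw [Finset.mem_range] at hi
      omega
    simp [hi']

theorem hasDerivAt_schurP_snd (n : ℕ) (u v : ℝ) :
    HasDerivAt (fun s => schurP (n + 2) u s) (schurP n u v) v := by
  unfold schurP
  have hsum : HasDerivAt (fun s : ℝ => ∑ i ∈ Finset.range ((n + 2) / 2 + 1),
      u ^ (n + 2 - 2 * i) * s ^ i / ((n + 2 - 2 * i).factorial * i.factorial : ℝ))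
      (∑ i ∈ Finset.range ((n + 2) / 2 + 1),
        u ^ (n + 2 - 2 * i) * ((i : ℝ) * v ^ (i - 1)) /
          ((n + 2 - 2 * i).factorial * i.factorial : ℝ)) v :=
    HasDerivAt.fun_sum fun i _ => ((hasDerivAt_pow _ v).const_mul _).div_const _
  convert hsum using 1
  rw [show (n + 2) / 2 + 1 = n / 2 + 1 + 1 by omega, Finset.sum_range_succ' _ (n / 2 + 1)]
  simp only [Nat.cast_zero, zero_mul, mul_zero, zero_div, add_zero]
  refine Finset.sum_congr rfl fun i _ => ?_
  rw [show n + 2 - 2 * (i + 1) = n - 2 * i by omega, Nat.factorial_succ, Nat.add_sub_cancel]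
  push_cast
  have hf := Nat.cast_ne_zero (R := ℝ).2 (n - 2 * i).factorial_ne_zero
  have hg := Nat.cast_ne_zero (R := ℝ).2 i.factorial_ne_zero
  have hs : (i : ℝ) + 1 ≠ 0 := by positivity
  field_simp

theorem differentiable_schurP (n : ℕ) :
    Differentiable ℝ fun p : ℝ × ℝ => schurP n p.1 p.2 := by
  unfold schurP
  fun_prop

theorem hasDerivAt_pu {f : ℝ × ℝ → ℝ} {p : ℝ × ℝ} (hf : DifferentiableAt ℝ f p) :
    HasDerivAt (fun s => f (s, p.2)) (pu f p) p.1 :=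
  HasFDerivAt.comp_hasDerivAt (f := fun s : ℝ => (s, p.2)) p.1 hf.hasFDerivAt
    ((hasDerivAt_id p.1).prodMk (hasDerivAt_const p.1 p.2))

theorem hasDerivAt_pv {f : ℝ × ℝ → ℝ} {p : ℝ × ℝ} (hf : DifferentiableAt ℝ f p) :
    HasDerivAt (fun s => f (p.1, s)) (pv f p) p.2 :=
  HasFDerivAt.comp_hasDerivAt (f := fun s : ℝ => (p.1, s)) p.2 hf.hasFDerivAt
    ((hasDerivAt_const p.2 p.1).prodMk (hasDerivAt_id p.2))

theorem stmt13 (k : ℕ)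
    (t x : ℝ × ℝ → ℝ)
    (ht : ∀ p : ℝ × ℝ, t p = schurP (k + 1) p.1 p.2)
    (hx : ∀ p : ℝ × ℝ, x p = schurP (k + 2) p.1 p.2 - p.1 * schurP (k + 1) p.1 p.2) :
    ∀ p : ℝ × ℝ, pu t p * pv x p - pv t p * pu x p = (schurP k p.1 p.2) ^ 2 := by
  intro p
  obtain rfl : t = fun p => schurP (k + 1) p.1 p.2 := funext ht
  obtain rfl : x = fun p => schurP (k + 2) p.1 p.2 - p.1 * schurP (k + 1) p.1 p.2 := funext hx
  have dt := differentiable_schurP (k + 1)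
  have dx : Differentiable ℝ fun p : ℝ × ℝ =>
      schurP (k + 2) p.1 p.2 - p.1 * schurP (k + 1) p.1 p.2 :=
    (differentiable_schurP (k + 2)).sub (differentiable_fst.mul dt)
  have htu := (hasDerivAt_pu (dt p)).unique (hasDerivAt_schurP_fst k p.1 p.2)
  have hxu := (hasDerivAt_pu (dx p)).unique ((hasDerivAt_schurP_fst (k + 1) p.1 p.2).sub
    ((hasDerivAt_id p.1).mul (hasDerivAt_schurP_fst k p.1 p.2)))
  have hxv := (hasDerivAt_pv (dx p)).unique ((hasDerivAt_schurP_snd k p.1 p.2).sub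
    ((hasDerivAt_pv (dt p)).const_mul p.1))
  rw [htu, hxu, hxv]
  simp only [id]
  ring
end

section
/- Let N ≥ 3 and let W: ℝ^N → ℝ be a smooth function satisfying ∂W/∂u_m = ∂^m W/∂u_1^m for all m = 2, …, N. Define t = ∂W/∂u_2 and x = ∂W/∂u_1 − u_1 ∂W/∂u_2. Then at every point p where ∂^l W/∂u_1^l (p) = 0 for all l = 3, …, N, one has ∂t/∂u_j (p) = 0 and ∂x/∂u_j (p) = 0 for all j = 1, …, N−2. -/
/-- Partial derivative of `f : ℝ^N → ℝ` in the `j`-th coordinate direction. -/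
noncomputable def pdN {N : ℕ} (j : Fin N) (f : (Fin N → ℝ) → ℝ) (p : Fin N → ℝ) : ℝ :=
  fderiv ℝ f p (Pi.single j 1)

/-- `m`-th iterated partial derivative with respect to the first coordinate `u_1`. -/
noncomputable def du1iter {N : ℕ} (h : 0 < N) : ℕ → ((Fin N → ℝ) → ℝ) → ((Fin N → ℝ) → ℝ)
  | 0, f => f
  | m + 1, f => pdN ⟨0, h⟩ (du1iter h m f)

theorem contDiff_pdN {N : ℕ} (j : Fin N) {f : (Fin N → ℝ) → ℝ} (hf : ContDiff ℝ (⊤ : ℕ∞) f) :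
    ContDiff ℝ (⊤ : ℕ∞) (pdN j f) :=
  (hf.fderiv_right (m := (⊤ : ℕ∞)) (by simp)).clm_apply contDiff_const

theorem contDiff_du1iter {N : ℕ} (h : 0 < N) (k : ℕ) {f : (Fin N → ℝ) → ℝ}
    (hf : ContDiff ℝ (⊤ : ℕ∞) f) : ContDiff ℝ (⊤ : ℕ∞) (du1iter h k f) := by
  induction k with
  | zero => exact hf
  | succ k ih => exact contDiff_pdN _ ih

theorem pdN_comm {N : ℕ} (i j : Fin N) {f : (Fin N → ℝ) → ℝ} (hf : ContDiff ℝ (⊤ : ℕ∞) f) :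
    pdN i (pdN j f) = pdN j (pdN i f) := by
  have hd : Differentiable ℝ (fderiv ℝ f) :=
    (hf.fderiv_right (m := (⊤ : ℕ∞)) (by simp)).differentiable (by simp)
  have key (i j : Fin N) (p : Fin N → ℝ) : pdN i (pdN j f) p =
      fderiv ℝ (fderiv ℝ f) p (Pi.single i 1) (Pi.single j 1) := by
    have h := (hd p).hasFDerivAt.clm_apply
      (hasFDerivAt_const (Pi.single j (1 : ℝ) : Fin N → ℝ) p)
    change fderiv ℝ (fun q => fderiv ℝ f q (Pi.single j 1)) p (Pi.single i 1) = _
    rw [h.fderiv]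
    simp
  funext p
  rw [key, key]
  have htwo : (2 : WithTop ℕ∞) ≤ (⊤ : ℕ∞) :=
    WithTop.coe_le_coe.2 (le_top : (2 : ℕ∞) ≤ ⊤)
  exact (hf.contDiffAt.isSymmSndFDerivAt (by simpa using htwo)).eq _ _

theorem pdN_du1iter_comm {N : ℕ} (h : 0 < N) (j : Fin N) (k : ℕ) {f : (Fin N → ℝ) → ℝ}
    (hf : ContDiff ℝ (⊤ : ℕ∞) f) :
    pdN j (du1iter h k f) = du1iter h k (pdN j f) := by
  induction k with
  | zero => rfl
  | succ k ih =>
    change pdN j (pdN _ (du1iter h k f)) = pdN _ (du1iter h k (pdN j f))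
    rw [pdN_comm _ _ (contDiff_du1iter h k hf), ih]

theorem du1iter_du1iter {N : ℕ} (h : 0 < N) (k m : ℕ) (f : (Fin N → ℝ) → ℝ) :
    du1iter h k (du1iter h m f) = du1iter h (k + m) f := by
  induction k with
  | zero => rw [Nat.zero_add]; rfl
  | succ k ih =>
    rw [Nat.succ_add]
    change pdN _ (du1iter h k (du1iter h m f)) = pdN _ (du1iter h (k + m) f)
    rw [ih]

theorem pdN_du1iter_eq {N : ℕ} (h : 0 < N) {f : (Fin N → ℝ) → ℝ} (hf : ContDiff ℝ (⊤ : ℕ∞) f)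
    (hsys : ∀ i : Fin N, 1 ≤ (i : ℕ) → ∀ p, pdN i f p = du1iter h ((i : ℕ) + 1) f p)
    (j : Fin N) (k : ℕ) : pdN j (du1iter h k f) = du1iter h (k + (j + 1)) f := by
  rcases Nat.eq_zero_or_pos (j : ℕ) with hj | hj
  · obtain rfl : j = ⟨0, h⟩ := Fin.ext hj
    rfl
  · rw [pdN_du1iter_comm h j k hf, funext (hsys j hj), du1iter_du1iter]

theorem stmt14 (N : ℕ) (hN : 3 ≤ N) (W : (Fin N → ℝ) → ℝ) (hW : ContDiff ℝ (⊤ : ℕ∞) W)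
    (hsys : ∀ i : Fin N, 1 ≤ (i : ℕ) →
      ∀ p, pdN i W p = du1iter (by omega) ((i : ℕ) + 1) W p)
    (t x : (Fin N → ℝ) → ℝ)
    (ht : ∀ p, t p = pdN (⟨1, by omega⟩ : Fin N) W p)
    (hx : ∀ p, x p = pdN (⟨0, by omega⟩ : Fin N) W p
      - p ⟨0, by omega⟩ * pdN (⟨1, by omega⟩ : Fin N) W p)
    (p : Fin N → ℝ)
    (hp : ∀ l : ℕ, 3 ≤ l → l ≤ N → du1iter (by omega : 0 < N) l W p = 0) :
    ∀ j : Fin N, (j : ℕ) + 3 ≤ N → pdN j t p = 0 ∧ pdN j x p = 0 := by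
  have h0 : 0 < N := by omega
  have hW1 : pdN (⟨0, h0⟩ : Fin N) W = du1iter h0 1 W := rfl
  have hW2 : pdN (⟨1, by omega⟩ : Fin N) W = du1iter h0 2 W := funext (hsys _ le_rfl)
  have hcoord (q : Fin N → ℝ) : HasFDerivAt (fun q : Fin N → ℝ => q ⟨0, h0⟩)
      (ContinuousLinearMap.proj (R := ℝ) (φ := fun _ : Fin N => ℝ) ⟨0, h0⟩) q :=
    hasFDerivAt_apply _ _
  have hdiff (k : ℕ) : HasFDerivAt (du1iter h0 k W) (fderiv ℝ (du1iter h0 k W) p) p :=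
    ((contDiff_du1iter h0 k hW).differentiable (by simp) p).hasFDerivAt
  have htW : t = du1iter h0 2 W := by rw [← hW2]; exact funext ht
  have hxW : x = fun q => du1iter h0 1 W q - q ⟨0, h0⟩ * du1iter h0 2 W q := by
    rw [← hW1, ← hW2]; exact funext hx
  intro j hj
  have hk (k : ℕ) : fderiv ℝ (du1iter h0 k W) p (Pi.single j 1) = du1iter h0 (k + (j + 1)) W p :=
    congrFun (pdN_du1iter_eq h0 hW hsys j k) p
  have hvan : du1iter h0 (2 + (j + 1)) W p = 0 := hp _ (by omega) (by omega)
  refine ⟨by rw [htW]; exact (hk 2).trans hvan, ?_⟩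
  have hxd := (hdiff 1).sub ((hcoord p).mul (hdiff 2))
  have hxj : pdN j x p = du1iter h0 (1 + (j + 1)) W p
      - (Pi.single j 1 : Fin N → ℝ) ⟨0, h0⟩ * du1iter h0 2 W p := by
    rw [hxW]
    refine (congrArg (fun L => L (Pi.single j 1)) hxd.fderiv).trans ?_
    simp [hk, hvan, mul_comm]
  rw [hxj]
  rcases Nat.eq_zero_or_pos (j : ℕ) with hj0 | hj0
  · obtain rfl : j = ⟨0, h0⟩ := Fin.ext hj0
    simp
  · have hne : (⟨0, h0⟩ : Fin N) ≠ j := fun h => by simp [← h] at hj0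
    rw [Pi.single_eq_of_ne hne, hp _ (by omega) (by omega)]
    simp
end
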